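/- arXiv:1908.06811 — 2 statements merged into one kernel-verified Lean document; each statement's English description precedes it below -/
import Mathlib

section
/- Let k be a field of characteristic ≠ 2, let ℓ/k be a quadratic field extension, and let c, d ∈ k³ be ℓ-admissible triples. Then the division algebras A(ℓ, c) and A(ℓ, d) are isomorphic as k-algebras if and only if there exists a ∈ ℓ, a ≠ 0, such that d₁ = c₁, d₂ = c₂/a², and d₃ = c₃/(a·σ(a)). -/
open Module Function

variable {k ℓ : Type}

/-- The function `q_c : ℓ × ℓ → ℓ` associated with a triple `c = (c₁, c₂, c₃) ∈ k³`. -/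
def qc [Field k] [Field ℓ] [Algebra k ℓ] (σ : ℓ ≃ₐ[k] ℓ) (c : k × k × k) (x y : ℓ) : ℓ :=
  (1 - algebraMap k ℓ c.1) * x ^ 2 + algebraMap k ℓ c.1 * (x * σ x)
    - algebraMap k ℓ c.2.1 * y ^ 2 - algebraMap k ℓ c.2.2 * (y * σ y)

/-- A triple `c ∈ k³` is `ℓ`-admissible if `q_c` is anisotropic. -/
def IsAdmissibleTriple [Field k] [Field ℓ] [Algebra k ℓ] (σ : ℓ ≃ₐ[k] ℓ)
    (c : k × k × k) : Prop :=
  ∀ x y : ℓ, qc σ c x y = 0 → x = 0 ∧ y = 0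

/-- The multiplication of the 4-dimensional `k`-algebra `A(ℓ, c)` on `ℓ × ℓ`. -/
def Amul [Field k] [Field ℓ] [Algebra k ℓ] (σ : ℓ ≃ₐ[k] ℓ) (c : k × k × k)
    (p q : ℓ × ℓ) : ℓ × ℓ :=
  (p.1 * q.1 + (algebraMap k ℓ c.2.1 * p.2 + algebraMap k ℓ c.2.2 * σ p.2) * q.2,
   p.2 * q.1 + ((1 - algebraMap k ℓ c.1) * p.1 + algebraMap k ℓ c.1 * σ p.1) * q.2)

/-- A quadratic extension of characteristic `≠ 2` with nontrivial automorphism `σ` has a basis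
`1, i` with `σ i = -i` and `i * i` in the base field. -/
lemma exists_antifixed_generator [Field k] [Field ℓ] [Algebra k ℓ]
    (hchar : (2 : k) ≠ 0) (hquad : finrank k ℓ = 2)
    (σ : ℓ ≃ₐ[k] ℓ) (hσ : ∃ x : ℓ, σ x ≠ x) :
    ∃ (i : ℓ) (e : k), i ≠ 0 ∧ σ i = -i ∧ i * i = algebraMap k ℓ e ∧
      ∀ z : ℓ, ∃ s t : k, z = algebraMap k ℓ s + algebraMap k ℓ t * i := by
  obtain ⟨x, hx⟩ := hσ
  have hli : LinearIndependent k ![(1 : ℓ), x] := by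
    rw [LinearIndependent.pair_iff]
    intro s t h
    have h' : algebraMap k ℓ s + algebraMap k ℓ t * x = 0 := by
      simpa [Algebra.smul_def] using h
    have hσ' := congrArg σ h'
    simp only [map_add, map_mul, AlgEquiv.commutes, map_zero] at hσ'
    have ht : algebraMap k ℓ t = 0 := by
      have : algebraMap k ℓ t * (σ x - x) = 0 := by linear_combination hσ' - h'
      exact (mul_eq_zero.mp this).resolve_right (sub_ne_zero.mpr hx)
    have hs : algebraMap k ℓ s = 0 := by rw [ht] at h'; simpa using h'
    exact ⟨(map_eq_zero _).mp hs, (map_eq_zero _).mp ht⟩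
  have hspan : ∀ z : ℓ, ∃ s t : k, z = algebraMap k ℓ s + algebraMap k ℓ t * x := by
    intro z
    have : FiniteDimensional k ℓ := .of_finrank_eq_succ hquad
    have htop := hli.span_eq_top_of_card_eq_finrank' (by simp [hquad])
    have hz : z ∈ Submodule.span k (Set.range ![(1 : ℓ), x]) := htop ▸ Submodule.mem_top
    rw [Matrix.range_cons, Matrix.range_cons, Matrix.range_empty, Set.union_empty,
      Set.singleton_union, Submodule.mem_span_pair] at hz
    obtain ⟨s, t, h⟩ := hz
    exact ⟨s, t, by rw [← h]; simp [Algebra.smul_def]⟩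
  obtain ⟨p, q, hpq⟩ := hspan (x * x)
  have hpq' := congrArg σ hpq
  simp only [map_add, map_mul, AlgEquiv.commutes] at hpq'
  have hsum : σ x = algebraMap k ℓ q - x := by
    have : (σ x - x) * (σ x + x - algebraMap k ℓ q) = 0 := by linear_combination hpq' - hpq
    linear_combination (mul_eq_zero.mp this).resolve_left (sub_ne_zero.mpr hx)
  have hhalf : 2 * algebraMap k ℓ (q / 2) = algebraMap k ℓ q := by
    have := congrArg (algebraMap k ℓ) (mul_div_cancel₀ q hchar)
    rw [← this]
    simp [map_ofNat]
  refine ⟨x - algebraMap k ℓ (q / 2), p + (q / 2) ^ 2, ?_, ?_, ?_, ?_⟩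
  · intro h
    apply hx
    rw [sub_eq_zero.mp h, AlgEquiv.commutes]
  · rw [map_sub, AlgEquiv.commutes, hsum]
    linear_combination -hhalf
  · rw [map_add, map_pow]
    linear_combination hpq - x * hhalf
  · intro z
    obtain ⟨s, t, h⟩ := hspan z
    refine ⟨s + t * (q / 2), t, ?_⟩
    rw [map_add, map_mul, h]
    ring

/-- `r` lies in the right nucleus of `A(ℓ, c)`. -/
def InRightNucleus [Field k] [Field ℓ] [Algebra k ℓ] (σ : ℓ ≃ₐ[k] ℓ) (c : k × k × k)
    (r : ℓ × ℓ) : Prop :=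
  ∀ p q, Amul σ c (Amul σ c p q) r = Amul σ c p (Amul σ c q r)

section

variable [Field k] [Field ℓ] [Algebra k ℓ] {σ : ℓ ≃ₐ[k] ℓ} {c d : k × k × k}

lemma Amul_one (p : ℓ × ℓ) : Amul σ c p (1, 0) = p := by simp [Amul]

lemma one_Amul (p : ℓ × ℓ) : Amul σ c (1, 0) p = p := by simp [Amul]

lemma inRightNucleus_left (w : ℓ) : InRightNucleus σ c (w, 0) := by
  intro p q
  simp only [Amul, Prod.mk.injEq]
  constructor <;> ring

lemma InRightNucleus.map {φ : ℓ × ℓ → ℓ × ℓ} (hφ : Surjective φ)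
    (hmul : ∀ p q, φ (Amul σ c p q) = Amul σ d (φ p) (φ q)) {r : ℓ × ℓ}
    (hr : InRightNucleus σ c r) : InRightNucleus σ d (φ r) := by
  intro p q
  obtain ⟨p, rfl⟩ := hφ p
  obtain ⟨q, rfl⟩ := hφ q
  simp only [← hmul, hr p q]

lemma InRightNucleus.of_map {φ : ℓ × ℓ → ℓ × ℓ} (hφ : Injective φ)
    (hmul : ∀ p q, φ (Amul σ c p q) = Amul σ d (φ p) (φ q)) {r : ℓ × ℓ}
    (hr : InRightNucleus σ d (φ r)) : InRightNucleus σ c r := by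
  intro p q
  apply hφ
  simp only [hmul, hr (φ p) (φ q)]

/-- If the right nucleus is larger than `ℓ`, then `A(ℓ, c)` is a biquadratic or a quaternion
algebra. -/
lemma InRightNucleus.triple_eq (h2 : (2 : ℓ) ≠ 0) {i : ℓ} {e : k} (hi : i ≠ 0)
    (hσi : σ i = -i) (hie : i * i = algebraMap k ℓ e) {u v : ℓ} (hv : v ≠ 0)
    (h : InRightNucleus σ c (u, v)) :
    (c.1 = 0 ∧ c.2.2 = 0) ∨ (c.1 = 1 ∧ c.2.1 = 0) := by
  have h₁ := congrArg Prod.snd (h (i, 0) (i, 0))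
  have h₂ := congrArg Prod.fst (h (0, 1) (i, 0))
  simp only [Amul, hσi, map_zero, map_one, mul_zero, zero_mul, add_zero, zero_add, mul_one,
    one_mul] at h₁ h₂
  rw [hie, AlgEquiv.commutes, ← hie] at h₁
  have hc1 : algebraMap k ℓ c.1 * (algebraMap k ℓ c.1 - 1) = 0 := by
    have : 2 * 2 * (i * i * v) * (algebraMap k ℓ c.1 * (algebraMap k ℓ c.1 - 1)) = 0 := by
      linear_combination -h₁
    exact (mul_eq_zero.mp this).resolve_left
      (mul_ne_zero (mul_ne_zero h2 h2) (mul_ne_zero (mul_ne_zero hi hi) hv))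
  have h2iv : 2 * (i * v) ≠ 0 := mul_ne_zero h2 (mul_ne_zero hi hv)
  rcases mul_eq_zero.mp hc1 with h0 | h0
  · refine Or.inl ⟨(map_eq_zero _).mp h0, (map_eq_zero (algebraMap k ℓ)).mp ?_⟩
    rw [h0] at h₂
    have : 2 * (i * v) * algebraMap k ℓ c.2.2 = 0 := by linear_combination -h₂
    exact (mul_eq_zero.mp this).resolve_left h2iv
  · have h1 : algebraMap k ℓ c.1 = 1 := sub_eq_zero.mp h0
    refine Or.inr ⟨(algebraMap k ℓ).injective (by rw [h1, map_one]),
      (map_eq_zero (algebraMap k ℓ)).mp ?_⟩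
    rw [h1] at h₂
    have : 2 * (i * v) * algebraMap k ℓ c.2.1 = 0 := by linear_combination h₂
    exact (mul_eq_zero.mp this).resolve_left h2iv

lemma inRightNucleus_of_triple_eq (hσσ : ∀ z, σ (σ z) = z)
    (h : (c.1 = 0 ∧ c.2.2 = 0) ∨ (c.1 = 1 ∧ c.2.1 = 0)) (r : ℓ × ℓ) :
    InRightNucleus σ c r := by
  intro p q
  rcases h with ⟨h₁, h₂⟩ | ⟨h₁, h₂⟩ <;>
  · simp only [Amul, h₁, h₂, map_zero, map_one, map_add, map_mul, AlgEquiv.commutes, hσσ,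
      Prod.mk.injEq, sub_self, sub_zero, zero_mul, zero_add, add_zero, one_mul]
    constructor <;> ring

lemma IsAdmissibleTriple.ne_zero (hc : IsAdmissibleTriple σ c) {a : ℓ}
    (h₂ : algebraMap k ℓ d.2.1 * a ^ 2 = algebraMap k ℓ c.2.1)
    (h₃ : algebraMap k ℓ d.2.2 * (a * σ a) = algebraMap k ℓ c.2.2) : a ≠ 0 := by
  rintro rfl
  have := hc 0 1 (by simp [qc, ← h₂, ← h₃])
  exact one_ne_zero this.2

/-- Left multiplication by a nonzero element of a quaternion algebra `A(ℓ, (1, 0, c₃))` is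
bijective. -/
lemma IsAdmissibleTriple.bijective_Amul (hc : IsAdmissibleTriple σ c)
    (h₁ : c.1 = 1) (h₂ : c.2.1 = 0) {s : ℓ × ℓ} (hs : s ≠ 0) : Bijective (Amul σ c s) := by
  obtain ⟨x, y⟩ := s
  have hN : x * σ x - algebraMap k ℓ c.2.2 * (y * σ y) ≠ 0 := by
    intro h
    obtain ⟨rfl, rfl⟩ := hc x y (by simp [qc, h₁, h₂, h])
    exact hs rfl
  rw [bijective_iff_has_inverse]
  refine ⟨fun r ↦ ((σ x * r.1 - algebraMap k ℓ c.2.2 * σ y * r.2) /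
      (x * σ x - algebraMap k ℓ c.2.2 * (y * σ y)),
    (x * r.2 - y * r.1) / (x * σ x - algebraMap k ℓ c.2.2 * (y * σ y))), ?_, ?_⟩
  · intro r
    simp only [Amul, h₁, h₂, map_zero, map_one]
    ext
    · rw [div_eq_iff hN]; ring
    · rw [div_eq_iff hN]; ring
  · intro r
    simp only [Amul, h₁, h₂, map_zero, map_one]
    ext
    · linear_combination r.1 * mul_inv_cancel₀ hN
    · linear_combination r.2 * mul_inv_cancel₀ hN

/-- An isomorphism preserving `ℓ` is determined by the image of `(0, 1)`. -/
lemma exists_scaling_of_map_left (h2 : (2 : ℓ) ≠ 0) {i : ℓ} (hi : i ≠ 0) (hσi : σ i = -i)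
    {φ : ℓ × ℓ → ℓ × ℓ} (hφ : Injective φ)
    (hmul : ∀ p q, φ (Amul σ c p q) = Amul σ d (φ p) (φ q))
    {τ : ℓ ≃ₐ[k] ℓ} (hτσ : ∀ x, τ (σ x) = σ (τ x)) (hτ : ∀ x, φ (x, 0) = (τ x, 0)) :
    ∃ a : ℓ, a ≠ 0 ∧ d.1 = c.1 ∧
        algebraMap k ℓ d.2.1 * a ^ 2 = algebraMap k ℓ c.2.1 ∧
        algebraMap k ℓ d.2.2 * (a * σ a) = algebraMap k ℓ c.2.2 := by
  obtain ⟨⟨b, a⟩, hba⟩ : ∃ r, φ (0, 1) = r := ⟨_, rfl⟩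
  have hr : ∀ y, φ (0, y) = (b * τ y, a * τ y) := by
    intro y
    have := hmul (0, 1) (y, 0)
    simpa [hba, hτ, Amul] using this
  have ha : a ≠ 0 := by
    rintro rfl
    have : φ (0, 1) = φ (τ.symm b, 0) := by rw [hba, hτ]; simp
    simpa using hφ this
  have hL := hmul (i, 0) (0, 1)
  have hR := fun y ↦ hmul (0, y) (0, 1)
  have hτi : τ i ≠ 0 := by simpa using hi
  have hστi : σ (τ i) = -τ i := by rw [← hτσ, hσi, map_neg]
  simp only [Amul, hba, hτ, hr, hσi, hστi, map_zero, map_one, mul_zero, zero_mul, add_zero,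
    zero_add, mul_one, map_add, map_sub, map_mul, map_neg, AlgEquiv.commutes,
    Prod.mk.injEq, hτσ] at hL hR
  have h1 : d.1 = c.1 := by
    apply (algebraMap k ℓ).injective
    have : 2 * (a * τ i) * (algebraMap k ℓ d.1 - algebraMap k ℓ c.1) = 0 := by
      linear_combination hL.2
    exact sub_eq_zero.mp ((mul_eq_zero.mp this).resolve_left
      (mul_ne_zero h2 (mul_ne_zero ha hτi)))
  have hb : b = 0 := by
    by_contra hb
    have hc1 : algebraMap k ℓ c.1 = 0 := by
      have : 2 * (b * τ i) * algebraMap k ℓ c.1 = 0 := by linear_combination -hL.1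
      exact (mul_eq_zero.mp this).resolve_left (mul_ne_zero h2 (mul_ne_zero hb hτi))
    have := (hR 1).2
    rw [h1, hc1] at this
    have h0 : 2 * (a * b) = 0 := by
      simp only [map_one] at this
      linear_combination -this
    exact mul_ne_zero h2 (mul_ne_zero ha hb) h0
  subst hb
  have e₁ := (hR 1).1
  have e₂ := (hR i).1
  simp only [map_one, hστi] at e₁ e₂
  have e₂' : algebraMap k ℓ c.2.1 - algebraMap k ℓ c.2.2 =
      algebraMap k ℓ d.2.1 * a ^ 2 - algebraMap k ℓ d.2.2 * (a * σ a) :=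
    mul_left_cancel₀ hτi (by linear_combination e₂)
  refine ⟨a, ha, h1, mul_left_cancel₀ h2 ?_, mul_left_cancel₀ h2 ?_⟩
  · linear_combination -e₁ - e₂'
  · linear_combination -e₁ + e₂'

lemma Amul_comm_of_triple_eq (h₁ : c.1 = 0) (h₃ : c.2.2 = 0) (p q : ℓ × ℓ) :
    Amul σ c p q = Amul σ c q p := by
  simp only [Amul, h₁, h₃, map_zero, Prod.mk.injEq]
  constructor <;> ring

lemma not_Amul_comm (h2 : (2 : ℓ) ≠ 0) {i : ℓ} (hi : i ≠ 0) (hσi : σ i = -i) (h₁ : c.1 = 1) :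
    Amul σ c (i, 0) (0, 1) ≠ Amul σ c (0, 1) (i, 0) := by
  intro h
  have := congrArg Prod.snd h
  simp only [Amul, h₁, hσi, map_one] at this
  exact mul_ne_zero h2 hi (by linear_combination -this)

/-- The biquadratic case. -/
lemma exists_scaling_of_biquadratic (h2 : (2 : ℓ) ≠ 0)
    (hc : IsAdmissibleTriple σ c) {φ : ℓ × ℓ → ℓ × ℓ}
    (hmul : ∀ p q, φ (Amul σ c p q) = Amul σ d (φ p) (φ q))
    (hk : ∀ t : k, φ (algebraMap k ℓ t, 0) = (algebraMap k ℓ t, 0))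
    (hc₁ : c.1 = 0) (hc₃ : c.2.2 = 0) (hd₁ : d.1 = 0) (hd₃ : d.2.2 = 0) :
    ∃ a : ℓ, a ≠ 0 ∧ d.1 = c.1 ∧
        algebraMap k ℓ d.2.1 * a ^ 2 = algebraMap k ℓ c.2.1 ∧
        algebraMap k ℓ d.2.2 * (a * σ a) = algebraMap k ℓ c.2.2 := by
  obtain ⟨⟨b, a⟩, hba⟩ : ∃ r, φ (0, 1) = r := ⟨_, rfl⟩
  have h := hmul (0, 1) (0, 1)
  simp only [Amul, hba, hc₁, hc₃, hd₁, hd₃, map_zero, mul_zero, zero_mul, add_zero, zero_add,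
    mul_one, sub_zero, one_mul, hk, Prod.mk.injEq] at h
  have hab : a * b = 0 :=
    (mul_eq_zero.mp (show 2 * (a * b) = 0 by linear_combination -h.2)).resolve_left h2
  have hcd : algebraMap k ℓ d.2.1 * a ^ 2 = algebraMap k ℓ c.2.1 := by
    rcases mul_eq_zero.mp hab with rfl | rfl
    · have := hc b 1 (by
        simp only [qc, hc₁, hc₃, map_zero]
        linear_combination -h.1)
      exact absurd this.2 one_ne_zero
    · linear_combination -h.1
  have hcd' : algebraMap k ℓ d.2.2 * (a * σ a) = algebraMap k ℓ c.2.2 := by simp [hc₃, hd₃]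
  exact ⟨a, hc.ne_zero hcd hcd', by rw [hc₁, hd₁], hcd, hcd'⟩

/-- The quaternion case, by the Skolem–Noether argument. -/
lemma exists_scaling_of_quaternion (h2 : (2 : ℓ) ≠ 0) (hσσ : ∀ z, σ (σ z) = z)
    {i : ℓ} {e : k} (hi : i ≠ 0) (hσi : σ i = -i) (hie : i * i = algebraMap k ℓ e)
    (hc : IsAdmissibleTriple σ c) (hd : IsAdmissibleTriple σ d) {φ : ℓ × ℓ → ℓ × ℓ}
    (hadd : ∀ p q, φ (p + q) = φ p + φ q)
    (hmul : ∀ p q, φ (Amul σ c p q) = Amul σ d (φ p) (φ q))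
    (hk : ∀ t : k, φ (algebraMap k ℓ t, 0) = (algebraMap k ℓ t, 0))
    (hφi : (φ (i, 0)).2 ≠ 0)
    (hc₁ : c.1 = 1) (hc₂ : c.2.1 = 0) (hd₁ : d.1 = 1) (hd₂ : d.2.1 = 0) :
    ∃ a : ℓ, a ≠ 0 ∧ d.1 = c.1 ∧
        algebraMap k ℓ d.2.1 * a ^ 2 = algebraMap k ℓ c.2.1 ∧
        algebraMap k ℓ d.2.2 * (a * σ a) = algebraMap k ℓ c.2.2 := by
  have assoc : ∀ p q r, Amul σ d (Amul σ d p q) r = Amul σ d p (Amul σ d q r) :=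
    fun p q r ↦ inRightNucleus_of_triple_eq hσσ (Or.inr ⟨hd₁, hd₂⟩) r p q
  have add_mul' : ∀ p q r, Amul σ d (p + q) r = Amul σ d p r + Amul σ d q r := by
    intro p q r
    simp only [Amul, Prod.fst_add, Prod.snd_add, map_add, Prod.mk_add_mk, Prod.mk.injEq]
    constructor <;> ring
  have mul_add' : ∀ p q r, Amul σ d p (q + r) = Amul σ d p q + Amul σ d p r := by
    intro p q r
    simp only [Amul, Prod.fst_add, Prod.snd_add, Prod.mk_add_mk, Prod.mk.injEq]
    constructor <;> ring
  have scalar_comm : ∀ (t : k) p, Amul σ d (algebraMap k ℓ t, 0) p =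
      Amul σ d p (algebraMap k ℓ t, 0) := by
    intro t p
    simp only [Amul, map_zero, AlgEquiv.commutes, Prod.mk.injEq]
    constructor <;> ring
  set P := φ (i, 0) with hP
  set J := φ (0, 1) with hJ
  have hPP : Amul σ d P P = (algebraMap k ℓ e, 0) := by
    rw [hP, ← hmul, ← hk, ← hie]
    simp [Amul]
  have hII : Amul σ d (i, 0) (i, 0) = (algebraMap k ℓ e, 0) := by
    rw [← hie]
    simp [Amul]
  have hJJ : Amul σ d J J = (algebraMap k ℓ c.2.2, 0) := by
    rw [hJ, ← hmul, ← hk]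
    simp [Amul, hc₂]
  have hPJ : Amul σ d P J + Amul σ d J P = 0 := by
    rw [hJ, hP, ← hmul, ← hmul, ← hadd]
    have h0 : φ 0 = 0 := by simpa using hadd 0 0
    rw [← h0]
    congr 1
    simp [Amul, hc₁, hσi]
  have hs : P + (i, 0) ≠ 0 := fun h ↦ hφi (by simpa using congrArg Prod.snd h)
  obtain ⟨s, hsdef⟩ : ∃ s, s = P + (i, 0) := ⟨_, rfl⟩
  rw [← hsdef] at hs
  have hPs : Amul σ d P s = Amul σ d s (i, 0) := by
    rw [hsdef, mul_add', add_mul', hPP, hII, add_comm]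
  have hbij := hd.bijective_Amul hd₁ hd₂ hs
  obtain ⟨K, hK⟩ := hbij.2 (Amul σ d J s)
  have hKI : Amul σ d (i, 0) K + Amul σ d K (i, 0) = 0 := by
    apply hbij.1
    rw [mul_add', ← assoc, ← assoc, hK, ← hPs, assoc, assoc, ← hPs, hK, ← assoc, ← assoc,
      ← add_mul', hPJ]
    simp [Amul]
  have hKK : Amul σ d K K = (algebraMap k ℓ c.2.2, 0) := by
    apply hbij.1
    rw [← assoc, hK, assoc, hK, ← assoc, hJJ, scalar_comm]
  obtain ⟨b, a⟩ := K
  have hb : b = 0 := by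
    have := congrArg Prod.fst hKI
    simp only [Amul, map_zero, Prod.fst_add, Prod.fst_zero] at this
    have h0 : 2 * i * b = 0 := by linear_combination this
    exact (mul_eq_zero.mp h0).resolve_left (mul_ne_zero h2 hi)
  subst hb
  have h₃ : algebraMap k ℓ d.2.2 * (a * σ a) = algebraMap k ℓ c.2.2 := by
    have := congrArg Prod.fst hKK
    simp only [Amul, hd₂, map_zero] at this
    linear_combination this
  have h₂ : algebraMap k ℓ d.2.1 * a ^ 2 = algebraMap k ℓ c.2.1 := by simp [hc₂, hd₂]
  exact ⟨a, hc.ne_zero h₂ h₃, by rw [hc₁, hd₁], h₂, h₃⟩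

end

/-- Let `k` be a field of characteristic ≠ 2, `ℓ/k` a quadratic field
extension, and `c, d ∈ k³` two `ℓ`-admissible triples. Then the division algebras `A(ℓ, c)` and
`A(ℓ, d)` are isomorphic as `k`-algebras if and only if there is a nonzero `a ∈ ℓ` with
`d₁ = c₁`, `d₂ = c₂ / a²` and `d₃ = c₃ / (a·σ(a))`. -/
theorem Amul_iso_iff [Field k] [Field ℓ] [Algebra k ℓ]
    (hchar : (2 : k) ≠ 0) (hquad : finrank k ℓ = 2)
    (σ : ℓ ≃ₐ[k] ℓ) (hσ : ∃ x : ℓ, σ x ≠ x)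
    (c d : k × k × k) (hc : IsAdmissibleTriple σ c) (hd : IsAdmissibleTriple σ d) :
    (∃ φ : ℓ × ℓ → ℓ × ℓ, Function.Bijective φ ∧
        (∀ p q : ℓ × ℓ, φ (p + q) = φ p + φ q) ∧
        (∀ (t : k) (p : ℓ × ℓ), φ (t • p) = t • φ p) ∧
        (∀ p q : ℓ × ℓ, φ (Amul σ c p q) = Amul σ d (φ p) (φ q))) ↔
    (∃ a : ℓ, a ≠ 0 ∧ d.1 = c.1 ∧
        algebraMap k ℓ d.2.1 * a ^ 2 = algebraMap k ℓ c.2.1 ∧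
        algebraMap k ℓ d.2.2 * (a * σ a) = algebraMap k ℓ c.2.2) := by
  have h2 : (2 : ℓ) ≠ 0 := by
    simpa [map_ofNat] using (map_ne_zero (algebraMap k ℓ)).mpr hchar
  obtain ⟨i, e, hi, hσi, hie, hspan⟩ := exists_antifixed_generator hchar hquad σ hσ
  have hσσ : ∀ z, σ (σ z) = z := by
    intro z
    obtain ⟨s, t, rfl⟩ := hspan z
    simp [hσi]
  constructor
  · rintro ⟨φ, hφ, hadd, hsmul, hmul⟩
    have h1 : φ (1, 0) = (1, 0) := by
      obtain ⟨r, hr⟩ := hφ.2 (1, 0)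
      have := hmul (1, 0) r
      rw [one_Amul, hr, Amul_one] at this
      exact this.symm
    have hk : ∀ t : k, φ (algebraMap k ℓ t, 0) = (algebraMap k ℓ t, 0) := by
      intro t
      have := hsmul t (1, 0)
      rw [h1] at this
      simpa [Algebra.smul_def] using this
    by_cases hv : (φ (i, 0)).2 = 0
    · obtain ⟨u, hu⟩ : ∃ u, φ (i, 0) = (u, 0) := ⟨_, Prod.ext rfl hv⟩
      have huu : u * u = i * i := by
        have := hmul (i, 0) (i, 0)
        rw [hu] at this
        simp only [Amul, map_zero, mul_zero, zero_mul, add_zero, hie, hk, Prod.mk.injEq] at this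
        rw [hie, this.1]
      have hφx : ∀ s t : k, φ (algebraMap k ℓ s + algebraMap k ℓ t * i, 0) =
          (algebraMap k ℓ s + algebraMap k ℓ t * u, 0) := by
        intro s t
        have := hadd (algebraMap k ℓ s, 0) (t • (i, 0))
        rw [hsmul, hk, hu] at this
        simpa [Algebra.smul_def] using this
      rcases mul_self_eq_mul_self_iff.mp huu with rfl | rfl
      · refine exists_scaling_of_map_left h2 hi hσi hφ.1 hmul (τ := AlgEquiv.refl)
          (fun _ ↦ rfl) ?_
        intro x
        obtain ⟨s, t, rfl⟩ := hspan x
        simp [hφx]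
      · refine exists_scaling_of_map_left h2 hi hσi hφ.1 hmul (τ := σ) (fun _ ↦ rfl) ?_
        intro x
        obtain ⟨s, t, rfl⟩ := hspan x
        simp [hφx, hσi]
    · have hd' := ((inRightNucleus_left i).map hφ.2 hmul).triple_eq h2 hi hσi hie hv
      have hc' := ((inRightNucleus_of_triple_eq hσσ hd' (φ (0, 1))).of_map hφ.1 hmul).triple_eq
        h2 hi hσi hie one_ne_zero
      rcases hc' with ⟨hc₁, hc₃⟩ | ⟨hc₁, hc₂⟩ <;> rcases hd' with ⟨hd₁, hd₃⟩ | ⟨hd₁, hd₂⟩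
      · exact exists_scaling_of_biquadratic h2 hc hmul hk hc₁ hc₃ hd₁ hd₃
      · obtain ⟨p, hp⟩ := hφ.2 (i, 0)
        obtain ⟨q, hq⟩ := hφ.2 (0, 1)
        refine absurd ?_ (not_Amul_comm h2 hi hσi hd₁)
        rw [← hp, ← hq, ← hmul, Amul_comm_of_triple_eq hc₁ hc₃, hmul]
      · refine absurd (hφ.1 ?_) (not_Amul_comm h2 hi hσi hc₁)
        rw [hmul, Amul_comm_of_triple_eq hd₁ hd₃, hmul]
      · exact exists_scaling_of_quaternion h2 hσσ hi hσi hie hc hd hadd hmul hk hv hc₁ hc₂ hd₁ hd₂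
  · rintro ⟨a, ha, h₁, h₂, h₃⟩
    refine ⟨fun p ↦ (p.1, a * p.2), ?_, ?_, ?_, ?_⟩
    · rw [bijective_iff_has_inverse]
      exact ⟨fun p ↦ (p.1, a⁻¹ * p.2), fun p ↦ by simp [ha], fun p ↦ by simp [ha]⟩
    · intro p q
      simp [mul_add]
    · intro t p
      simp
    · intro p q
      simp only [Amul, h₁, ← h₂, ← h₃, map_mul, Prod.mk.injEq]
      constructor <;> ring
end

section
/- Let k be a field of characteristic ≠ 2 such that k*/(k*)² has order 2, let ℓ/k be a quadratic field extension with nontrivial k-automorphism σ, and suppose the norm map ℓ* → k*, x ↦ x·σ(x), is surjective. Then every ℓ-admissible triple c = (c₁, c₂, c₃) ∈ k³ satisfies c₂ ≠ 0; consequently every division algebra A(ℓ, c) with c ℓ-admissible is not associative, and there exists no A ∈ 𝒞(k) that is an associative division algebra with center k·1. -/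
open Module Function

variable {k ℓ : Type}

/-- A Kleinian pair for a nonassociative `k`-algebra `(A, mul)`. -/
def IsKleinPair [Field k] {A : Type} [AddCommGroup A] [Module k A]
    (mul : A →ₗ[k] A →ₗ[k] A) (α β : A ≃ₗ[k] A) : Prop :=
  (∀ x y : A, α (mul x y) = mul (α x) (α y)) ∧
  (∀ x y : A, β (mul x y) = mul (β x) (β y)) ∧
  (∀ x : A, α (α x) = x) ∧ (∀ x : A, β (β x) = x) ∧
  (∀ x : A, α (β x) = β (α x)) ∧
  α ≠ LinearEquiv.refl k A ∧ β ≠ LinearEquiv.refl k A ∧ α ≠ β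

section LinearAlgebra

/-- Five vectors in a four-dimensional space satisfy a nontrivial linear relation. -/
theorem exists_relation_five {K V : Type*} [Field K] [AddCommGroup V] [Module K V]
    [FiniteDimensional K V] (h : finrank K V = 4) (v₀ v₁ v₂ v₃ v₄ : V) :
    ∃ a b c d e : K, a • v₀ + b • v₁ + c • v₂ + d • v₃ + e • v₄ = 0 ∧
      ¬(a = 0 ∧ b = 0 ∧ c = 0 ∧ d = 0 ∧ e = 0) := by
  have hli : ¬ LinearIndependent K ![v₀, v₁, v₂, v₃, v₄] := fun hl => by
    have := hl.fintype_card_le_finrank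
    simp [h] at this
  obtain ⟨g, hg, i, hi⟩ := Fintype.not_linearIndependent_iff.1 hli
  refine ⟨g 0, g 1, g 2, g 3, g 4, by simpa [Fin.sum_univ_five] using hg, ?_⟩
  rintro ⟨h0, h1, h2, h3, h4⟩
  fin_cases i <;> simp_all

/-- Three vectors in a plane satisfy a nontrivial linear relation. -/
theorem exists_relation_three {K V : Type*} [Field K] [AddCommGroup V] [Module K V]
    (h : finrank K V = 2) (v₀ v₁ v₂ : V) :
    ∃ a b c : K, a • v₀ + b • v₁ + c • v₂ = 0 ∧ ¬(a = 0 ∧ b = 0 ∧ c = 0) := by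
  have : FiniteDimensional K V := FiniteDimensional.of_finrank_pos (by omega)
  have hli : ¬ LinearIndependent K ![v₀, v₁, v₂] := fun hl => by
    have := hl.fintype_card_le_finrank
    simp [h] at this
  obtain ⟨g, hg, i, hi⟩ := Fintype.not_linearIndependent_iff.1 hli
  refine ⟨g 0, g 1, g 2, by simpa [Fin.sum_univ_three] using hg, ?_⟩
  rintro ⟨h0, h1, h2⟩
  fin_cases i <;> simp_all

end LinearAlgebra

section Quadratic

/-- A nonscalar element of an algebra satisfies no nontrivial relation of degree one. -/
theorem eq_zero_of_add_smul_eq_zero {K A : Type*} [Field K] [Ring A] [Algebra K A] [Nontrivial A]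
    {x : A} (hx : ∀ s : K, x ≠ algebraMap K A s) {a b : K}
    (h : algebraMap K A a + b • x = 0) : a = 0 ∧ b = 0 := by
  have hb : b = 0 := by
    by_contra hb
    refine hx (-(b⁻¹ * a)) ?_
    have h2 := congrArg (b⁻¹ • ·) h
    simp only [smul_add, smul_smul, inv_mul_cancel₀ hb, one_smul, smul_zero] at h2
    rw [Algebra.smul_def] at h2
    rw [map_neg, map_mul]
    exact eq_neg_of_add_eq_zero_right h2
  subst hb
  simpa using h

/-- Completing the square: a nonscalar root of a nontrivial relation of degree two yields a
nonscalar element whose square is a scalar. -/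
theorem exists_sq_scalar {K A : Type*} [Field K] (h2 : (2 : K) ≠ 0) [Ring A] [Algebra K A]
    [Nontrivial A] {x : A} (hx : ∀ s : K, x ≠ algebraMap K A s) {a b c : K}
    (h : a • (1 : A) + b • x + c • (x * x) = 0) (hne : ¬(a = 0 ∧ b = 0 ∧ c = 0)) :
    ∃ (u : A) (d : K), u * u = algebraMap K A d ∧ ∀ s : K, u ≠ algebraMap K A s := by
  have hc : c ≠ 0 := by
    rintro rfl
    have := eq_zero_of_add_smul_eq_zero hx (a := a) (b := b)
      (by simpa [Algebra.algebraMap_eq_smul_one] using h)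
    exact hne ⟨this.1, this.2, rfl⟩
  refine ⟨(2 * c) • x + b • (1 : A), b * b - 4 * a * c, ?_, fun s hs => ?_⟩
  · have h3 : (4 * c) • (a • (1 : A) + b • x + c • (x * x)) = 0 := by rw [h, smul_zero]
    rw [Algebra.algebraMap_eq_smul_one]
    simp only [add_mul, mul_add, smul_mul_assoc, mul_smul_comm, mul_one, one_mul]
    rw [← sub_eq_zero, ← h3]
    module
  · have := eq_zero_of_add_smul_eq_zero hx (a := b - s) (b := 2 * c) (by
      rw [map_sub, ← hs, Algebra.algebraMap_eq_smul_one]; abel)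
    exact mul_ne_zero h2 hc this.2

/-- A quadratic extension in characteristic not two is generated by a square root `δ`, which the
nontrivial automorphism negates. -/
theorem exists_sqrt_generator {K L : Type*} [Field K] [Field L] [Algebra K L] (h2 : (2 : K) ≠ 0)
    (hquad : finrank K L = 2) (σ : L ≃ₐ[K] L) (hσ : ∃ x : L, σ x ≠ x) :
    ∃ (δ : L) (d : K), δ * δ = algebraMap K L d ∧ σ δ = -δ ∧ (∀ s : K, δ ≠ algebraMap K L s) ∧
      ∀ t : L, ∃ p q : K, t = algebraMap K L p + algebraMap K L q * δ := by
  obtain ⟨x, hx⟩ := hσ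
  have hxs : ∀ s : K, x ≠ algebraMap K L s := by
    rintro s rfl
    exact hx (σ.commutes s)
  obtain ⟨a, b, c, hrel, hne⟩ := exists_relation_three hquad 1 x (x * x)
  obtain ⟨δ, d, hd, hδ⟩ := exists_sq_scalar h2 hxs hrel hne
  have hspan : ∀ t : L, ∃ p q : K, t = algebraMap K L p + algebraMap K L q * δ := by
    intro t
    obtain ⟨a, b, c, hrel, hne⟩ := exists_relation_three hquad 1 δ t
    have hc : c ≠ 0 := by
      rintro rfl
      have := eq_zero_of_add_smul_eq_zero hδ (a := a) (b := b)
        (by simpa [Algebra.algebraMap_eq_smul_one] using hrel)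
      exact hne ⟨this.1, this.2, rfl⟩
    refine ⟨-(a / c), -(b / c), ?_⟩
    have hc' : algebraMap K L c ≠ 0 := by simpa using hc
    simp only [Algebra.smul_def] at hrel
    simp only [map_neg, map_div₀]
    field_simp
    linear_combination hrel
  refine ⟨δ, d, hd, ?_, hδ, hspan⟩
  have hsq : σ δ * σ δ = δ * δ := by rw [← map_mul, hd, σ.commutes]
  refine (mul_self_eq_mul_self_iff.1 hsq).resolve_left fun hfix => hx ?_
  obtain ⟨p, q, rfl⟩ := hspan x
  simp [hfix]

/-- If the squares have index two in `Kˣ`, the product of two nonsquares is a square. -/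
theorem isSquare_mul_of_index_two {K : Type*} [Field K]
    (hidx : ((powMonoidHom 2 : Kˣ →* Kˣ).range).index = 2) {a d : K}
    (ha : ¬IsSquare a) (hd : ¬IsSquare d) : IsSquare (a * d) := by
  have key : ∀ w : Kˣ, w ∈ (powMonoidHom 2 : Kˣ →* Kˣ).range → IsSquare (w : K) := by
    rintro w ⟨z, rfl⟩
    exact ⟨z, by simp [sq]⟩
  have ha0 : a ≠ 0 := by rintro rfl; exact ha IsSquare.zero
  have hd0 : d ≠ 0 := by rintro rfl; exact hd IsSquare.zero
  have h := key (Units.mk0 a ha0 * Units.mk0 d hd0)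
    ((Subgroup.mul_mem_iff_of_index_two hidx).2
      (iff_of_false (fun h => ha (key _ h)) (fun h => hd (key _ h))))
  simpa using h

end Quadratic

section Quaternion

/-- A four-dimensional central algebra without zero divisors, in characteristic not two, contains
a pair of anticommuting generators with scalar squares. -/
theorem exists_quaternion_generators {K A : Type*} [Field K] (h2 : (2 : K) ≠ 0) [Ring A]
    [Algebra K A] [FiniteDimensional K A] [NoZeroDivisors A] [Nontrivial A]
    (hdim : finrank K A = 4)
    (hcen : ∀ z : A, (∀ x, z * x = x * z) → ∃ s : K, z = algebraMap K A s) :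
    ∃ (u v : A) (a b : K), u * u = algebraMap K A a ∧ v * v = algebraMap K A b ∧
      u * v = -(v * u) ∧ (∀ s : K, u ≠ algebraMap K A s) ∧ v ≠ 0 := by
  have hnc : ∀ x : A, (∀ s : K, x ≠ algebraMap K A s) → ∃ w, x * w - w * x ≠ 0 := by
    intro x hx
    by_contra! hall
    obtain ⟨s, hs⟩ := hcen x fun y => sub_eq_zero.1 (hall y)
    exact hx s hs
  obtain ⟨x, hx⟩ : ∃ x : A, ∀ s : K, x ≠ algebraMap K A s := by
    by_contra! hall
    have h1 := finrank_le_one (R := K) (1 : A) fun w => by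
      obtain ⟨s, hs⟩ := hall w
      exact ⟨s, by rw [hs, Algebra.algebraMap_eq_smul_one]⟩
    omega
  obtain ⟨u, a, hu, hus⟩ : ∃ (u : A) (d : K),
      u * u = algebraMap K A d ∧ ∀ s : K, u ≠ algebraMap K A s := by
    obtain ⟨w, hw⟩ := hnc x hx
    obtain ⟨a, b, c, d, e, hrel, hne⟩ := exists_relation_five hdim 1 x (x * x) w (x * w)
    have hprod : (algebraMap K A d + e • x) * (x * w - w * x) = 0 := by
      have h3 : x * (a • (1 : A) + b • x + c • (x * x) + d • w + e • (x * w))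
          - (a • (1 : A) + b • x + c • (x * x) + d • w + e • (x * w)) * x = 0 := by
        rw [hrel]; simp
      rw [← h3, Algebra.algebraMap_eq_smul_one]
      simp only [add_mul, mul_add, mul_sub, smul_mul_assoc, mul_smul_comm, mul_one, one_mul,
        mul_assoc]
      module
    obtain ⟨rfl, rfl⟩ := eq_zero_of_add_smul_eq_zero hx
      ((mul_eq_zero.1 hprod).resolve_right hw)
    exact exists_sq_scalar h2 hx (by simpa using hrel) (by simpa using hne)
  have hu0 : u ≠ 0 := fun h => hus 0 (by simpa using h)
  obtain ⟨y, hy⟩ := hnc u hus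
  obtain ⟨v, hv⟩ : ∃ v, v = u * y - y * u := ⟨_, rfl⟩
  have hv0 : v ≠ 0 := hv ▸ hy
  have hanti : u * v = -(v * u) := by
    have hc : u * u * y = y * (u * u) := by rw [hu]; exact Algebra.commutes _ _
    rw [hv, mul_sub, sub_mul, ← mul_assoc, hc]
    noncomm_ring
  have hanti' : v * u = -(u * v) := by rw [hanti, neg_neg]
  obtain ⟨b, hb⟩ := hcen (v * v) fun z => by
    have hgu : v * v * u = u * (v * v) := by
      rw [mul_assoc, hanti', mul_neg, ← mul_assoc, hanti', neg_mul, neg_neg, mul_assoc]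
    have hgv : v * v * v = v * (v * v) := mul_assoc _ _ _
    have hguv : v * v * (u * v) = u * v * (v * v) := by
      rw [← mul_assoc, hgu, mul_assoc, mul_assoc, mul_assoc]
    obtain ⟨e₀, e₁, e₂, e₃, e₄, hrel, hne⟩ := exists_relation_five hdim 1 u v (u * v) z
    have he : e₄ ≠ 0 := by
      rintro rfl
      have hprod : (algebraMap K A e₂ + e₃ • u) * ((2 : K) • (u * v)) = 0 := by
        have h3 : u * (e₀ • (1 : A) + e₁ • u + e₂ • v + e₃ • (u * v) + (0 : K) • z)
            - (e₀ • (1 : A) + e₁ • u + e₂ • v + e₃ • (u * v) + (0 : K) • z) * u = 0 := by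
          rw [hrel]; simp
        rw [← h3, Algebra.algebraMap_eq_smul_one]
        simp only [add_mul, mul_add, smul_mul_assoc, mul_smul_comm, mul_one, one_mul,
          mul_assoc, hanti', mul_neg, zero_smul, mul_zero, zero_mul]
        module
      obtain ⟨rfl, rfl⟩ := eq_zero_of_add_smul_eq_zero hus
        ((mul_eq_zero.1 hprod).resolve_right (smul_ne_zero h2 (mul_ne_zero hu0 hv0)))
      have := eq_zero_of_add_smul_eq_zero hus (a := e₀) (b := e₁)
        (by simpa [Algebra.algebraMap_eq_smul_one] using hrel)
      exact hne ⟨this.1, this.2, rfl, rfl, rfl⟩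
    have h3 : v * v * (e₀ • (1 : A) + e₁ • u + e₂ • v + e₃ • (u * v) + e₄ • z)
        - (e₀ • (1 : A) + e₁ • u + e₂ • v + e₃ • (u * v) + e₄ • z) * (v * v) = 0 := by
      rw [hrel]; simp
    simp only [mul_add, add_mul, smul_mul_assoc, mul_smul_comm, hgu, hgv, hguv, mul_one,
      one_mul, add_sub_add_left_eq_sub, ← smul_sub] at h3
    exact sub_eq_zero.1 ((smul_eq_zero.1 h3).resolve_left he)
  exact ⟨u, v, a, b, hu, hb, hanti, hus, hv0⟩

/-- If `b = p² - a q²`, then an algebra without zero divisors cannot contain anticommuting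
nonzero elements with squares `a` and `b`. -/
theorem false_of_quaternion_norm {K A : Type*} [Field K] (h2 : (2 : K) ≠ 0) [Ring A]
    [Algebra K A] [NoZeroDivisors A] {u v : A} {a b p q : K}
    (hu : u * u = algebraMap K A a) (hv : v * v = algebraMap K A b) (hanti : u * v = -(v * u))
    (hu0 : u ≠ 0) (hv0 : v ≠ 0) (hb : b = p * p - a * (q * q)) : False := by
  have hanti' : v * u = -(u * v) := by rw [hanti, neg_neg]
  have hprod : (p • (1 : A) + (q • u + v)) * (p • (1 : A) - (q • u + v)) = 0 := by
    rw [Algebra.algebraMap_eq_smul_one] at hu hv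
    simp only [mul_sub, add_mul, mul_add, smul_mul_assoc, mul_smul_comm, mul_one, one_mul, hu, hv,
      hanti', hb]
    module
  have key : ∀ ε : K, ε ≠ 0 → p • (1 : A) + ε • (q • u + v) ≠ 0 := by
    intro ε hε h
    have h3 : u * (p • (1 : A) + ε • (q • u + v)) - (p • (1 : A) + ε • (q • u + v)) * u = 0 := by
      rw [h]; simp
    have h4 : (ε * 2) • (u * v) = 0 := by
      rw [← h3]
      simp only [add_mul, mul_add, smul_mul_assoc, mul_smul_comm, mul_one, one_mul, hanti']
      module
    exact smul_ne_zero (mul_ne_zero hε h2) (mul_ne_zero hu0 hv0) h4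
  rcases mul_eq_zero.1 hprod with h | h
  · exact key 1 one_ne_zero (by rwa [one_smul])
  · exact key (-1) (neg_ne_zero.2 one_ne_zero) (by rwa [neg_one_smul, ← sub_eq_add_neg])

end Quaternion

section DoubledAlgebra

/-- If the norm is surjective, admissible triples have nonzero second entry. -/
theorem IsAdmissibleTriple.snd_ne_zero [Field k] [Field ℓ] [Algebra k ℓ] {σ : ℓ ≃ₐ[k] ℓ}
    (hnorm : ∀ t : k, t ≠ 0 → ∃ x : ℓ, x * σ x = algebraMap k ℓ t) {c : k × k × k}
    (hc : IsAdmissibleTriple σ c) : c.2.1 ≠ 0 := by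
  intro h
  by_cases h3 : c.2.2 = 0
  · exact one_ne_zero (hc 0 1 (by simp [qc, h, h3])).2
  · obtain ⟨y, hy⟩ := hnorm c.2.2⁻¹ (inv_ne_zero h3)
    refine one_ne_zero (hc 1 y ?_).1
    simp [qc, h, hy, h3]

/-- If `A(ℓ, c)` is associative and `c₂ ≠ 0`, then `c = (0, c₂, 0)`. -/
theorem eq_zero_of_Amul_assoc [Field k] [Field ℓ] [Algebra k ℓ] (h2 : (2 : k) ≠ 0)
    {σ : ℓ ≃ₐ[k] ℓ} {δ : ℓ} {d : k} (hδ : δ * δ = algebraMap k ℓ d) (hσδ : σ δ = -δ)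
    (hδ0 : δ ≠ 0) {c : k × k × k} (hc2 : c.2.1 ≠ 0)
    (hassoc : ∀ p q r : ℓ × ℓ, Amul σ c (Amul σ c p q) r = Amul σ c p (Amul σ c q r)) :
    c.1 = 0 ∧ c.2.2 = 0 := by
  obtain ⟨c₁, c₂, c₃⟩ := c
  have hd0 : algebraMap k ℓ d ≠ 0 := hδ ▸ mul_ne_zero hδ0 hδ0
  have h2' : (2 : ℓ) ≠ 0 := by
    rw [← map_ofNat (algebraMap k ℓ) 2]
    exact (map_ne_zero _).2 h2
  have e₁ := congrArg Prod.snd (hassoc (δ, 0) (δ, 0) (0, 1))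
  have e₂ := congrArg Prod.fst (hassoc (δ, 0) (0, 1) (0, 1))
  simp only [Amul, hσδ, map_zero, map_one, map_mul, mul_zero, zero_mul, add_zero, zero_add,
    mul_one, map_add, map_sub, map_neg, AlgEquiv.commutes] at e₁ e₂
  have hc1 : c₁ = 0 ∨ c₁ = 1 := by
    have h : (4 * algebraMap k ℓ d) * (algebraMap k ℓ (c₁ * (c₁ - 1))) = 0 := by
      simp only [map_mul, map_sub, map_one, ← hδ]
      linear_combination -e₁
    have h4 : (4 : ℓ) ≠ 0 := by
      have := mul_ne_zero h2' h2'
      norm_num at this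
      exact this
    have h5 := (mul_eq_zero.1 h).resolve_left (mul_ne_zero h4 hd0)
    rw [map_eq_zero, mul_eq_zero, sub_eq_zero] at h5
    exact h5
  rcases hc1 with rfl | rfl
  · refine ⟨rfl, ?_⟩
    have h : (2 * δ) * algebraMap k ℓ c₃ = 0 := by
      simp only [map_zero] at e₂
      linear_combination -e₂
    simpa using (mul_eq_zero.1 h).resolve_left (mul_ne_zero h2' hδ0)
  · have h : (2 * δ) * algebraMap k ℓ c₂ = 0 := by
      simp only [map_one] at e₂
      linear_combination -e₂
    exact absurd (by simpa using (mul_eq_zero.1 h).resolve_left (mul_ne_zero h2' hδ0)) hc2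

end DoubledAlgebra

section StructureConstants

/-- The ring structure given by an associative unital bilinear multiplication. -/
abbrev ringOfBilinear {K A : Type*} [Field K] [AddCommGroup A] [Module K A]
    (mul : A →ₗ[K] A →ₗ[K] A) (one : A) (hone : ∀ x : A, mul one x = x ∧ mul x one = x)
    (hassoc : ∀ x y z : A, mul (mul x y) z = mul x (mul y z)) : Ring A :=
  { (inferInstance : AddCommGroup A) with
    mul := fun x y => mul x y
    one := one
    mul_assoc := hassoc
    one_mul := fun x => (hone x).1
    mul_one := fun x => (hone x).2
    left_distrib := fun x y z => map_add (mul x) y z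
    right_distrib := fun x y z => LinearMap.map_add₂ mul x y z
    zero_mul := fun x => LinearMap.map_zero₂ mul x
    mul_zero := fun x => map_zero (mul x) }

end StructureConstants

/-- Let `k` be a field of characteristic ≠ 2 with `k*/(k*)²` of order 2, let
`ℓ/k` be a quadratic field extension, and suppose the norm map `ℓ* → k*` is surjective. Then
every `ℓ`-admissible triple `c` has `c₂ ≠ 0`; consequently every `A(ℓ, c)` with `c`
`ℓ`-admissible is not associative, and there is no `A ∈ 𝒞(k)` that is an associative division
algebra with center `k·1`. -/
theorem surjective_norm_no_skewfield [Field k] [Field ℓ] [Algebra k ℓ]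
    (hchar : (2 : k) ≠ 0)
    (hidx : ((powMonoidHom 2 : kˣ →* kˣ).range).index = 2)
    (hquad : finrank k ℓ = 2)
    (σ : ℓ ≃ₐ[k] ℓ) (hσ : ∃ x : ℓ, σ x ≠ x)
    (hnorm : ∀ t : k, t ≠ 0 → ∃ x : ℓ, x * σ x = algebraMap k ℓ t) :
    (∀ c : k × k × k, IsAdmissibleTriple σ c → c.2.1 ≠ 0) ∧
    (∀ c : k × k × k, IsAdmissibleTriple σ c →
      ¬ ∀ p q r : ℓ × ℓ, Amul σ c (Amul σ c p q) r = Amul σ c p (Amul σ c q r)) ∧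
    (∀ (A : Type) [AddCommGroup A] [Module k A] [FiniteDimensional k A]
      (mul : A →ₗ[k] A →ₗ[k] A) (one : A),
      finrank k A = 4 →
      (∀ x : A, mul one x = x ∧ mul x one = x) →
      (∀ a : A, a ≠ 0 →
        Function.Bijective (fun x => mul a x) ∧ Function.Bijective (fun x => mul x a)) →
      Set.range (fun s : k => s • one) ⊂
        {z : A | ∀ x y : A, mul (mul x y) z = mul x (mul y z)} →
      (∃ α β : A ≃ₗ[k] A, IsKleinPair mul α β) →
      ¬((∀ x y z : A, mul (mul x y) z = mul x (mul y z)) ∧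
        {z : A | ∀ x : A, mul z x = mul x z} = Set.range (fun s : k => s • one))) := by
  obtain ⟨δ, d, hδ, hσδ, hδs, hspan⟩ := exists_sqrt_generator hchar hquad σ hσ
  have hδ0 : δ ≠ 0 := fun h => hδs 0 (by simpa using h)
  have hd : ¬IsSquare d := by
    rintro ⟨s, rfl⟩
    rw [map_mul] at hδ
    rcases mul_self_eq_mul_self_iff.1 hδ with h | h
    · exact hδs s h
    · exact hδs (-s) (by rw [h, map_neg])
  refine ⟨fun c hc => hc.snd_ne_zero hnorm, fun c hc hassoc => ?_, ?_⟩
  · have hc2 := hc.snd_ne_zero hnorm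
    obtain ⟨h1, h3⟩ := eq_zero_of_Amul_assoc hchar hδ hσδ hδ0 hc2 hassoc
    by_cases hsq : IsSquare c.2.1
    · obtain ⟨s, hs⟩ := hsq
      refine one_ne_zero (hc (algebraMap k ℓ s) 1 ?_).2
      simp [qc, h1, h3, hs, sq]
    · obtain ⟨s, hs⟩ := isSquare_mul_of_index_two hidx hsq hd
      refine hδ0 (hc (algebraMap k ℓ s) δ ?_).2
      have hs' := congrArg (algebraMap k ℓ) hs
      simp only [map_mul] at hs'
      simp only [qc, h1, h3, map_zero]
      linear_combination -hs' - algebraMap k ℓ c.2.1 * hδ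
  · rintro A _ _ _ mul one hdim hone hdiv - - ⟨hassoc, hcen⟩
    let _ : Ring A := ringOfBilinear mul one hone hassoc
    let _ : Algebra k A := Algebra.ofModule (fun r x y => LinearMap.map_smul₂ mul r x y)
      (fun r x y => map_smul (mul x) r y)
    have : Nontrivial A := Module.nontrivial_of_finrank_pos (R := k) (by omega)
    have : NoZeroDivisors A := ⟨fun {x y} hxy => or_iff_not_imp_left.2 fun hx =>
      (hdiv x hx).1.1 (hxy.trans (mul_zero x).symm)⟩
    obtain ⟨u, v, a, b, hu, hv, hanti, hus, hv0⟩ := exists_quaternion_generators hchar hdim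
      fun z hz => by
        obtain ⟨s, hs⟩ := hcen.subset hz
        exact ⟨s, by rw [Algebra.algebraMap_eq_smul_one]; exact hs.symm⟩
    have hu0 : u ≠ 0 := fun h => hus 0 (by simpa using h)
    have hb0 : b ≠ 0 := by
      rintro rfl
      rw [map_zero] at hv
      exact mul_ne_zero hv0 hv0 hv
    have ha : ¬IsSquare a := by
      rintro ⟨s, rfl⟩
      rw [map_mul] at hu
      have hprod : (u - algebraMap k A s) * (u + algebraMap k A s) = 0 := by
        rw [sub_mul, mul_add, mul_add, hu, Algebra.commutes s u]
        abel
      rcases mul_eq_zero.1 hprod with h | h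
      · exact hus s (sub_eq_zero.1 h)
      · exact hus (-s) (by rw [map_neg]; exact eq_neg_of_add_eq_zero_left h)
    have ha0 : a ≠ 0 := by rintro rfl; exact ha IsSquare.zero
    obtain ⟨s, hs⟩ := isSquare_mul_of_index_two hidx ha hd
    obtain ⟨t, ht⟩ := hnorm b hb0
    obtain ⟨p, q, rfl⟩ := hspan t
    have hb : b = p * p - d * (q * q) := by
      apply (algebraMap k ℓ).injective
      rw [← ht]
      simp only [map_add, map_mul, map_sub, AlgEquiv.commutes, hσδ, ← hδ]
      ring
    refine false_of_quaternion_norm hchar hu hv hanti hu0 hv0 (p := p) (q := q * s / a) ?_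
    rw [hb]
    field_simp
    linear_combination -q ^ 2 * hs
end
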